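/- Let s = 1/4 and let f : ℤ → ℝ be the indicator function of the singleton {1}. Then for every q ∈ (1, 4/3], Σ_{x∈ℤ} G(f)(x)^q = ∞; in particular, the square function G is not bounded on ℓ^q(ℤ) for such q, where G(f)(x) = (∫₀^∞ |∇(P_t f)|²(x) dt)^{1/2}. -/

import Mathlib

open MeasureTheory Real

/-- The kernel `K_s` of the fractional discrete Laplacian on `ℤ`. -/
noncomputable def Ker (s : ℝ) (m : ℤ) : ℝ :=
  if m = 0 then 0
  else ((4 : ℝ) ^ s * Real.Gamma (1 / 2 + s) / (Real.sqrt Real.pi * |Real.Gamma (-s)|)) *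
    (Real.Gamma ((m.natAbs : ℝ) - s) / Real.Gamma ((m.natAbs : ℝ) + 1 + s))

/-- The fractional discrete Laplacian `L = (-Δ)^s` acting pointwise. -/
noncomputable def Lop (s : ℝ) (f : ℤ → ℝ) : ℤ → ℝ :=
  fun x => ∑' y : ℤ, (f x - f y) * Ker s (x - y)

/-- The heat semigroup `P_t = exp (-t L)`, given by the exponential series of the
bounded operator `-tL` (evaluated pointwise). -/
noncomputable def heat (s t : ℝ) (f : ℤ → ℝ) : ℤ → ℝ :=
  fun x => ∑' n : ℕ, ((-t) ^ n / (n.factorial : ℝ)) * ((Lop s)^[n] f x)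

/-- The squared modulus of the gradient, `|∇f|²(x) = Σ_y K_s(y-x) (f x - f y)²`. -/
noncomputable def gradSq (s : ℝ) (f : ℤ → ℝ) (x : ℤ) : ℝ :=
  ∑' y : ℤ, Ker s (y - x) * (f x - f y) ^ 2

/-- The squared modulus of the modified gradient,
`|∇̃f|²(x) = Σ_{y : |f y| < |f x|} K_s(y-x) (f x - f y)²`. -/
noncomputable def mgradSq (s : ℝ) (f : ℤ → ℝ) (x : ℤ) : ℝ :=
  ∑' y : {y : ℤ // |f y| < |f x|}, Ker s ((y : ℤ) - x) * (f x - f (y : ℤ)) ^ 2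

/-- The `ℓ^q` norm on `ℤ` with counting measure (for finite `q`). -/
noncomputable def lqNorm (q : ℝ) (f : ℤ → ℝ) : ℝ :=
  (∑' x : ℤ, |f x| ^ q) ^ (1 / q)

open Filter Topology NormedSpace

open scoped RealInnerProductSpace

/-! ### The kernel -/

lemma Ker_neg (s : ℝ) (m : ℤ) : Ker s (-m) = Ker s m := by
  simp [Ker]

lemma Gamma_add_half_le {x : ℝ} (hx : 0 < x) :
    Real.Gamma (x + 1 / 2) ≤ √x * Real.Gamma x := by
  have h := Real.Gamma_mul_add_mul_le_rpow_Gamma_mul_rpow_Gamma hx (by linarith : 0 < x + 1)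
    (by norm_num : (0 : ℝ) < 1 / 2) (by norm_num : (0 : ℝ) < 1 / 2) (by norm_num)
  have hG := Real.Gamma_pos_of_pos hx
  rw [← Real.sqrt_eq_rpow, ← Real.sqrt_eq_rpow, Real.Gamma_add_one hx.ne',
    Real.sqrt_mul hx.le] at h
  calc Real.Gamma (x + 1 / 2) = Real.Gamma (1 / 2 * x + 1 / 2 * (x + 1)) := by ring_nf
    _ ≤ _ := h
    _ = √x * (√(Real.Gamma x) * √(Real.Gamma x)) := by ring
    _ = _ := by rw [Real.mul_self_sqrt hG.le]

lemma Gamma_add_three_halves_le {x : ℝ} (hx : 0 < x) :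
    Real.Gamma (x + 3 / 2) ≤ √(x + 1) * x * Real.Gamma x := by
  have h := Gamma_add_half_le (by linarith : 0 < x + 1)
  rw [Real.Gamma_add_one hx.ne', add_assoc] at h
  norm_num at h
  linarith

lemma le_Gamma_add_three_halves {x : ℝ} (hx : 0 < x) :
    √(x + 1 / 2) * x * Real.Gamma x ≤ Real.Gamma (x + 3 / 2) := by
  have hx' : 0 < x + 1 / 2 := by linarith
  have h := Gamma_add_half_le hx'
  have h1 : x + 1 / 2 + 1 / 2 = x + 1 := by ring
  have h2 : x + 3 / 2 = x + 1 / 2 + 1 := by ring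
  rw [h1, Real.Gamma_add_one hx.ne'] at h
  rw [h2, Real.Gamma_add_one hx'.ne']
  calc √(x + 1 / 2) * x * Real.Gamma x = √(x + 1 / 2) * (x * Real.Gamma x) := by ring
    _ ≤ √(x + 1 / 2) * (√(x + 1 / 2) * Real.Gamma (x + 1 / 2)) := by gcongr
    _ = (√(x + 1 / 2) * √(x + 1 / 2)) * Real.Gamma (x + 1 / 2) := by ring
    _ = _ := by rw [Real.mul_self_sqrt hx'.le]

lemma rpow_three_halves {n : ℝ} (hn : 0 < n) : n ^ (3 / 2 : ℝ) = √n * n := by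
  rw [Real.sqrt_eq_rpow, ← Real.rpow_add_one hn.ne']
  norm_num

lemma Gamma_ratio_le {n : ℝ} (hn : 1 ≤ n) :
    Real.Gamma (n - 1 / 4) / Real.Gamma (n + 1 + 1 / 4) ≤ 2 * (1 / n ^ (3 / 2 : ℝ)) := by
  have hx : 0 < n - 1 / 4 := by linarith
  have h := le_Gamma_add_three_halves hx
  have hG := Real.Gamma_pos_of_pos hx
  have hG' : 0 < Real.Gamma (n + 1 + 1 / 4) := Real.Gamma_pos_of_pos (by linarith)
  have h1 : √n * (n / 2) ≤ √(n - 1 / 4 + 1 / 2) * (n - 1 / 4) := by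
    gcongr <;> linarith
  have h2 : n - 1 / 4 + 3 / 2 = n + 1 + 1 / 4 := by ring
  rw [h2] at h
  have hn' : 0 < √n * n := by positivity
  rw [rpow_three_halves (by linarith), mul_one_div, div_le_div_iff₀ hG' hn']
  nlinarith [mul_le_mul_of_nonneg_right h1 hG.le]

lemma le_Gamma_ratio {n : ℝ} (hn : 1 ≤ n) :
    1 / 2 * (1 / n ^ (3 / 2 : ℝ)) ≤ Real.Gamma (n - 1 / 4) / Real.Gamma (n + 1 + 1 / 4) := by
  have hx : 0 < n - 1 / 4 := by linarith
  have h := Gamma_add_three_halves_le hx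
  have hG := Real.Gamma_pos_of_pos hx
  have hG' : 0 < Real.Gamma (n + 1 + 1 / 4) := Real.Gamma_pos_of_pos (by linarith)
  have h0 : √(n - 1 / 4 + 1) ≤ 2 * √n := by
    rw [show (2 : ℝ) = √4 by rw [show (4 : ℝ) = 2 ^ 2 by norm_num]; simp,
      ← Real.sqrt_mul (by norm_num)]
    exact Real.sqrt_le_sqrt (by linarith)
  have h1 : √(n - 1 / 4 + 1) * (n - 1 / 4) ≤ (2 * √n) * n := by
    gcongr
    linarith
  have h2 : n - 1 / 4 + 3 / 2 = n + 1 + 1 / 4 := by ring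
  rw [h2] at h
  have hn' : 0 < √n * n := by positivity
  rw [rpow_three_halves (by linarith), mul_one_div, div_le_div_iff₀ hn' hG']
  nlinarith [mul_le_mul_of_nonneg_right h1 hG.le]

/-- The normalizing constant of the kernel `Ker (1 / 4)`. -/
noncomputable def kerConst : ℝ :=
  (4 : ℝ) ^ (1 / 4 : ℝ) * Real.Gamma (1 / 2 + 1 / 4) /
    (Real.sqrt Real.pi * |Real.Gamma (-(1 / 4))|)

lemma kerConst_pos : 0 < kerConst := by
  have h1 : 0 < Real.Gamma (1 / 2 + 1 / 4) := Real.Gamma_pos_of_pos (by norm_num)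
  have h2 : Real.Gamma (-(1 / 4)) ≠ 0 := by
    refine Real.Gamma_ne_zero fun m h => ?_
    have h4 : ((1 : ℕ) : ℝ) = ((4 * m : ℕ) : ℝ) := by push_cast; linarith
    have := Nat.cast_injective h4
    omega
  unfold kerConst
  positivity

lemma Ker_quarter_of_ne_zero {m : ℤ} (hm : m ≠ 0) :
    Ker (1 / 4) m = kerConst *
      (Real.Gamma ((m.natAbs : ℝ) - 1 / 4) / Real.Gamma ((m.natAbs : ℝ) + 1 + 1 / 4)) := by
  rw [Ker, if_neg hm, kerConst]

lemma one_le_natAbs_cast {m : ℤ} (hm : m ≠ 0) : (1 : ℝ) ≤ m.natAbs := by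
  exact_mod_cast Int.natAbs_pos.2 hm

lemma le_Ker_quarter {m : ℤ} (hm : m ≠ 0) :
    kerConst / 2 * (1 / (m.natAbs : ℝ) ^ (3 / 2 : ℝ)) ≤ Ker (1 / 4) m := by
  rw [Ker_quarter_of_ne_zero hm, div_eq_mul_one_div, mul_assoc]
  exact mul_le_mul_of_nonneg_left (le_Gamma_ratio (one_le_natAbs_cast hm)) kerConst_pos.le

lemma Ker_quarter_nonneg (m : ℤ) : 0 ≤ Ker (1 / 4) m := by
  rcases eq_or_ne m 0 with rfl | hm
  · simp [Ker]
  · have := kerConst_pos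
    exact le_trans (by positivity) (le_Ker_quarter hm)

lemma Ker_quarter_le (m : ℤ) :
    Ker (1 / 4) m ≤ kerConst * (2 * (1 / (m.natAbs : ℝ) ^ (3 / 2 : ℝ))) := by
  rcases eq_or_ne m 0 with rfl | hm
  · simp [Ker]
  · rw [Ker_quarter_of_ne_zero hm]
    exact mul_le_mul_of_nonneg_left (Gamma_ratio_le (one_le_natAbs_cast hm)) kerConst_pos.le

lemma summable_Ker_quarter : Summable (Ker (1 / 4)) := by
  have h : Summable fun n : ℕ => kerConst * (2 * (1 / (n : ℝ) ^ (3 / 2 : ℝ))) :=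
    ((Real.summable_one_div_nat_rpow.2 (by norm_num)).mul_left 2).mul_left _
  refine Summable.of_nonneg_of_le Ker_quarter_nonneg Ker_quarter_le ?_
  exact Summable.of_nat_of_neg (by simpa using h) (by simpa using h)

/-! ### Shifts and the fractional Laplacian on `ℓ²(ℤ)` -/

/-- The real Hilbert space `ℓ²(ℤ)`. -/
abbrev EllTwo : Type := lp (fun _ : ℤ => ℝ) 2

/-- Translation by `z` on `ℓ²(ℤ)`. -/
noncomputable def shift (z : ℤ) : EllTwo →ₗᵢ[ℝ] EllTwo where
  toFun v := ⟨fun x => v (x + z), memℓp_gen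
    ((Equiv.addRight z).summable_iff.2 ((memℓp_gen_iff (by norm_num)).1 (lp.memℓp v)))⟩
  map_add' _ _ := rfl
  map_smul' _ _ := rfl
  norm_map' v := by
    have h2 : (0 : ℝ) < (2 : ENNReal).toReal := by norm_num
    refine (Real.rpow_left_inj (norm_nonneg _) (norm_nonneg _) h2.ne').1 ?_
    rw [lp.norm_rpow_eq_tsum h2, lp.norm_rpow_eq_tsum h2]
    exact (Equiv.addRight z).tsum_eq fun x => ‖v x‖ ^ (2 : ENNReal).toReal

lemma shift_apply (z : ℤ) (v : EllTwo) (x : ℤ) : shift z v x = v (x + z) := rfl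

/-- The fractional Laplacian as a norm-convergent series of difference operators. -/
noncomputable def lapl (s : ℝ) : EllTwo →L[ℝ] EllTwo :=
  ∑' z : ℤ, Ker s z • (1 - (shift z).toContinuousLinearMap)

lemma summable_lapl {s : ℝ} (hK : Summable (Ker s)) :
    Summable fun z : ℤ => Ker s z • (1 - (shift z).toContinuousLinearMap) := by
  refine Summable.of_norm_bounded (hK.abs.mul_right 2) fun z => ?_
  rw [norm_smul, Real.norm_eq_abs]
  gcongr
  refine ContinuousLinearMap.opNorm_le_bound _ (by norm_num) fun v => ?_
  have h : ‖v - shift z v‖ ≤ ‖v‖ + ‖shift z v‖ := norm_sub_le _ _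
  rw [LinearIsometry.norm_map] at h
  change ‖v - shift z v‖ ≤ _
  linarith

lemma hasSum_lapl {s : ℝ} (hK : Summable (Ker s)) (v : EllTwo) :
    HasSum (fun z : ℤ => Ker s z • (v - shift z v)) (lapl s v) :=
  (summable_lapl hK).hasSum.mapL (ContinuousLinearMap.apply ℝ EllTwo v)

lemma lapl_apply {s : ℝ} (hK : Summable (Ker s)) (v : EllTwo) (x : ℤ) :
    lapl s v x = Lop s v x := by
  have h := (hasSum_lapl hK v).mapL (lp.evalCLM ℝ (fun _ : ℤ => ℝ) 2 x)
  change HasSum (fun z : ℤ => Ker s z * (v x - v (x + z))) (lapl s v x) at h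
  rw [← h.tsum_eq, Lop]
  refine Eq.trans (tsum_congr fun z => ?_) ((Equiv.addLeft x).tsum_eq _)
  have : x - (x + z) = -z := by ring
  simp [this, Ker_neg, mul_comm]

lemma inner_sub_shift (z : ℤ) (v : EllTwo) :
    2 * ⟪v - shift z v, v⟫ = ‖v - shift z v‖ ^ 2 := by
  have h := norm_sub_sq_real v (shift z v)
  rw [LinearIsometry.norm_map] at h
  rw [inner_sub_left, real_inner_self_eq_norm_sq, h, real_inner_comm]
  ring

lemma hasSum_dirichlet {s : ℝ} (hK : Summable (Ker s)) (v : EllTwo) :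
    HasSum (fun z : ℤ => Ker s z * ‖v - shift z v‖ ^ 2) (2 * ⟪lapl s v, v⟫) := by
  have h := ((hasSum_lapl hK v).mapL (innerSL ℝ v)).mul_left 2
  simp only [innerSL_apply_apply] at h
  rw [real_inner_comm] at h
  convert! h using 2 with z
  rw [inner_smul_right, real_inner_comm, mul_left_comm, inner_sub_shift]

lemma gradSq_eq (s : ℝ) (f : ℤ → ℝ) (x : ℤ) :
    gradSq s f x = ∑' z : ℤ, Ker s z * (f x - f (x + z)) ^ 2 := by
  rw [gradSq, ← (Equiv.addLeft x).tsum_eq]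
  simp

lemma sq_sub_le (v : EllTwo) (x z : ℤ) :
    (v x - v (x + z)) ^ 2 ≤ ‖v - shift z v‖ ^ 2 := by
  have h := lp.norm_apply_le_norm (p := 2) (by norm_num) (v - shift z v) x
  exact sq_le_sq.2 (by simpa [shift_apply] using h)

lemma summable_gradSq {s : ℝ} (hK : Summable (Ker s)) (hpos : ∀ m, 0 ≤ Ker s m)
    (v : EllTwo) (x : ℤ) : Summable fun z : ℤ => Ker s z * (v x - v (x + z)) ^ 2 :=
  Summable.of_nonneg_of_le (fun z => mul_nonneg (hpos z) (sq_nonneg _))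
    (fun z => mul_le_mul_of_nonneg_left (sq_sub_le v x z) (hpos z)) (hasSum_dirichlet hK v).summable

lemma gradSq_nonneg {s : ℝ} (hpos : ∀ m, 0 ≤ Ker s m) (f : ℤ → ℝ) (x : ℤ) :
    0 ≤ gradSq s f x :=
  tsum_nonneg fun _ => mul_nonneg (hpos _) (sq_nonneg _)

lemma gradSq_le_dirichlet {s : ℝ} (hK : Summable (Ker s)) (hpos : ∀ m, 0 ≤ Ker s m)
    (v : EllTwo) (x : ℤ) : gradSq s v x ≤ 2 * ⟪lapl s v, v⟫ := by
  rw [gradSq_eq]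
  exact hasSum_le (fun z => mul_le_mul_of_nonneg_left (sq_sub_le v x z) (hpos z))
    (summable_gradSq hK hpos v x).hasSum (hasSum_dirichlet hK v)

lemma le_gradSq {s : ℝ} (hK : Summable (Ker s)) (hpos : ∀ m, 0 ≤ Ker s m)
    (v : EllTwo) (x y : ℤ) : Ker s (y - x) * (v x - v y) ^ 2 ≤ gradSq s v x := by
  rw [gradSq_eq]
  have h := (summable_gradSq hK hpos v x).le_tsum (y - x)
    fun z _ => mul_nonneg (hpos z) (sq_nonneg _)
  simpa using h

/-! ### The heat flow on `ℓ²(ℤ)` -/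

/-- The heat flow `exp (-t L) v` in `ℓ²(ℤ)`. -/
noncomputable def flow (s : ℝ) (v : EllTwo) (t : ℝ) : EllTwo :=
  exp (t • (-lapl s)) v

lemma iterate_Lop {s : ℝ} (hK : Summable (Ker s)) (v : EllTwo) (n : ℕ) :
    (Lop s)^[n] v = ⇑((lapl s ^ n) v) := by
  induction n with
  | zero => simp
  | succ n ih =>
    rw [Function.iterate_succ_apply', ih, pow_succ']
    exact (funext fun x => lapl_apply hK _ x).symm

lemma heat_eq_flow {s : ℝ} (hK : Summable (Ker s)) (v : EllTwo) (t : ℝ) :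
    heat s t v = flow s v t := by
  funext x
  have h := ((exp_series_hasSum_exp' (𝕂 := ℝ) (t • (-lapl s))).mapL
    (ContinuousLinearMap.apply ℝ EllTwo v)).mapL (lp.evalCLM ℝ (fun _ : ℤ => ℝ) 2 x)
  refine Eq.trans (tsum_congr fun n => ?_) h.tsum_eq
  have hn : t • (-lapl s) = (-t) • lapl s := by simp
  rw [iterate_Lop hK, hn, smul_pow, smul_smul, div_eq_inv_mul]
  rfl

lemma hasDerivAt_flow (s : ℝ) (v : EllTwo) (t : ℝ) :
    HasDerivAt (flow s v) (-lapl s (flow s v t)) t :=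
  (ContinuousLinearMap.apply ℝ EllTwo v).hasFDerivAt.comp_hasDerivAt t
    (hasDerivAt_exp_smul_const' (-lapl s) t)

lemma flow_zero (s : ℝ) (v : EllTwo) : flow s v 0 = v := by
  simp [flow]

lemma continuous_flow (s : ℝ) (v : EllTwo) : Continuous (flow s v) :=
  continuous_iff_continuousAt.2 fun t => (hasDerivAt_flow s v t).continuousAt

lemma hasDerivAt_norm_sq_flow (s : ℝ) (v : EllTwo) (t : ℝ) :
    HasDerivAt (fun t => ‖flow s v t‖ ^ 2) (-(2 * ⟪lapl s (flow s v t), flow s v t⟫)) t := by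
  convert! (hasDerivAt_flow s v t).norm_sq using 1
  rw [inner_neg_right, real_inner_comm]
  ring

lemma dirichlet_nonneg {s : ℝ} (hK : Summable (Ker s)) (hpos : ∀ m, 0 ≤ Ker s m)
    (v : EllTwo) : 0 ≤ 2 * ⟪lapl s v, v⟫ :=
  (hasSum_dirichlet hK v).nonneg fun z => mul_nonneg (hpos z) (sq_nonneg _)

lemma antitone_norm_sq_flow {s : ℝ} (hK : Summable (Ker s)) (hpos : ∀ m, 0 ≤ Ker s m)
    (v : EllTwo) : Antitone fun t => ‖flow s v t‖ ^ 2 :=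
  antitone_of_hasDerivAt_nonpos (hasDerivAt_norm_sq_flow s v)
    fun _ => neg_nonpos.2 (dirichlet_nonneg hK hpos _)

lemma integrableOn_dirichlet_flow {s : ℝ} (hK : Summable (Ker s)) (hpos : ∀ m, 0 ≤ Ker s m)
    (v : EllTwo) :
    IntegrableOn (fun t => 2 * ⟪lapl s (flow s v t), flow s v t⟫) (Set.Ioi 0) := by
  have h := integrableOn_Ioi_deriv_of_nonpos' (a := 0)
    (fun t _ => hasDerivAt_norm_sq_flow s v t)
    (fun _ _ => neg_nonpos.2 (dirichlet_nonneg hK hpos _))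
    (tendsto_atTop_ciInf (antitone_norm_sq_flow hK hpos v)
      ⟨0, by rintro _ ⟨t, rfl⟩; positivity⟩)
  simpa using h.neg

lemma continuous_flow_apply (s : ℝ) (v : EllTwo) (x : ℤ) :
    Continuous fun t => flow s v t x :=
  (lp.evalCLM ℝ (fun _ : ℤ => ℝ) 2 x).continuous.comp (continuous_flow s v)

lemma norm_flow_le {s : ℝ} (hK : Summable (Ker s)) (hpos : ∀ m, 0 ≤ Ker s m)
    (v : EllTwo) {t : ℝ} (ht : 0 ≤ t) : ‖flow s v t‖ ≤ ‖v‖ := by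
  have h := antitone_norm_sq_flow hK hpos v ht
  simp only [flow_zero] at h
  exact (sq_le_sq₀ (norm_nonneg _) (norm_nonneg _)).1 h

lemma continuousOn_gradSq_flow {s : ℝ} (hK : Summable (Ker s)) (hpos : ∀ m, 0 ≤ Ker s m)
    (v : EllTwo) (x : ℤ) :
    ContinuousOn (fun t => gradSq s (flow s v t) x) (Set.Ioi 0) := by
  simp only [gradSq_eq]
  refine continuousOn_tsum (u := fun z => Ker s z * (2 * ‖v‖) ^ 2) (fun z => ?_)
    (hK.mul_right _) fun z t ht => ?_
  · exact (continuous_const.mul (((continuous_flow_apply s v x).sub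
      (continuous_flow_apply s v (x + z))).pow 2)).continuousOn
  · rw [Real.norm_of_nonneg (mul_nonneg (hpos z) (sq_nonneg _))]
    refine mul_le_mul_of_nonneg_left ((sq_sub_le _ x z).trans ?_) (hpos z)
    have h1 : ‖flow s v t - shift z (flow s v t)‖ ≤ _ := norm_sub_le _ _
    rw [LinearIsometry.norm_map] at h1
    have h2 := norm_flow_le hK hpos v (le_of_lt ht)
    gcongr
    linarith

lemma integrableOn_gradSq_flow {s : ℝ} (hK : Summable (Ker s)) (hpos : ∀ m, 0 ≤ Ker s m)
    (v : EllTwo) (x : ℤ) :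
    IntegrableOn (fun t => gradSq s (flow s v t) x) (Set.Ioi 0) := by
  refine (integrableOn_dirichlet_flow hK hpos v).mono'
    ((continuousOn_gradSq_flow hK hpos v x).aestronglyMeasurable measurableSet_Ioi)
    (Eventually.of_forall fun t => ?_)
  rw [Real.norm_of_nonneg (gradSq_nonneg hpos _ _)]
  exact gradSq_le_dirichlet hK hpos _ x

/-- For short times the heat flow of a point mass at `a` still charges mostly `a`, so its square
function is at least a fixed multiple of the kernel. -/
lemma exists_mul_Ker_le_integral {s : ℝ} (hK : Summable (Ker s)) (hpos : ∀ m, 0 ≤ Ker s m)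
    (a : ℤ) : ∃ c > 0, ∀ x ≠ a, c * Ker s (a - x) ≤
      ∫ t in Set.Ioi (0 : ℝ), gradSq s (flow s (lp.single 2 a 1) t) x := by
  set v : EllTwo := lp.single 2 a 1 with hv
  have hnear : ∀ᶠ t in 𝓝 (0 : ℝ), ‖flow s v t - v‖ < 1 / 4 := by
    have h := (continuous_flow s v).tendsto 0
    rw [flow_zero] at h
    simpa [dist_eq_norm] using h.eventually (Metric.ball_mem_nhds v (by norm_num : (0 : ℝ) < 1 / 4))
  obtain ⟨ε, hε, hball⟩ := Metric.eventually_nhds_iff.1 hnear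
  refine ⟨ε / 4, by positivity, fun x hx => ?_⟩
  have hlow : ∀ t ∈ Set.Ioo 0 ε, Ker s (a - x) * (1 / 4) ≤ gradSq s (flow s v t) x := by
    intro t ht
    refine le_trans (mul_le_mul_of_nonneg_left ?_ (hpos _)) (le_gradSq hK hpos _ x a)
    have hn := hball (y := t) (by simpa [abs_of_pos ht.1] using ht.2)
    have ha := (lp.norm_apply_le_norm (p := 2) (by norm_num) (flow s v t - v) a).trans_lt hn
    have hx' := (lp.norm_apply_le_norm (p := 2) (by norm_num) (flow s v t - v) x).trans_lt hn
    have hva : v a = 1 := lp.single_apply_self _ _ _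
    have hvx : v x = 0 := lp.single_apply_ne _ _ _ hx
    rw [lp.coeFn_sub, Pi.sub_apply, Real.norm_eq_abs, abs_lt] at ha hx'
    rw [hva] at ha
    rw [hvx] at hx'
    nlinarith
  have hInt := integrableOn_gradSq_flow hK hpos v x
  have hsub : Set.Ioo 0 ε ⊆ Set.Ioi 0 := fun t ht => ht.1
  calc ε / 4 * Ker s (a - x) = ∫ _ in Set.Ioo 0 ε, Ker s (a - x) * (1 / 4) := by
        rw [setIntegral_const]
        simp [hε.le]
        ring
    _ ≤ ∫ t in Set.Ioo 0 ε, gradSq s (flow s v t) x :=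
        setIntegral_mono_on (integrableOn_const (by simp)) (hInt.mono_set hsub)
          measurableSet_Ioo hlow
    _ ≤ _ := setIntegral_mono_set hInt (Eventually.of_forall fun t => gradSq_nonneg hpos _ _)
          hsub.eventuallyLE

/-- Counterexample: for `s = 1/4` and `f` the indicator of `{1}`, for every `q ∈ (1, 4/3]`
the series `Σ_x G(f)(x)^q` diverges; in particular `G f ∉ ℓ^q`, so `G` is not bounded on
`ℓ^q`. -/
theorem counterexample_G_unbounded (q : ℝ) (hq : q ∈ Set.Ioc (1 : ℝ) (4 / 3)) :
    (∑' x : ℤ, ENNReal.ofReal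
        ((Real.sqrt (∫ t in Set.Ioi (0 : ℝ),
          gradSq (1 / 4) (heat (1 / 4) t (fun y : ℤ => if y = 1 then (1 : ℝ) else 0)) x)) ^ q)
        = ⊤) ∧
      ¬ Summable (fun x : ℤ =>
        (Real.sqrt (∫ t in Set.Ioi (0 : ℝ),
          gradSq (1 / 4) (heat (1 / 4) t (fun y : ℤ => if y = 1 then (1 : ℝ) else 0)) x)) ^ q) := by
  have hf : (fun y : ℤ => if y = 1 then (1 : ℝ) else 0) = (lp.single 2 1 1 : EllTwo) := by
    funext y
    rw [lp.single_apply, Pi.single_apply]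
  simp only [hf, heat_eq_flow summable_Ker_quarter]
  set G : ℤ → ℝ := fun x =>
    (√(∫ t in Set.Ioi (0 : ℝ), gradSq (1 / 4) (flow (1 / 4) (lp.single 2 1 1) t) x)) ^ q with hG
  have hG0 : ∀ x, 0 ≤ G x := fun x => by positivity
  have hns : ¬ Summable G := by
    intro hsum
    obtain ⟨c, hc, hle⟩ := exists_mul_Ker_le_integral summable_Ker_quarter Ker_quarter_nonneg 1
    have hC : 0 < c * (kerConst / 2) := mul_pos hc (half_pos kerConst_pos)
    have hcomp : Summable fun n : ℕ => G ((n : ℤ) + 2) :=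
      hsum.comp_injective (i := fun n : ℕ => (n : ℤ) + 2) fun m n h => by simpa using h
    have hlow : ∀ n : ℕ, √(c * (kerConst / 2)) ^ q *
        (1 / ((n + 1 : ℕ) : ℝ) ^ (3 / 4 * q)) ≤ G ((n : ℤ) + 2) := by
      intro n
      have hn : (0 : ℝ) < ((n + 1 : ℕ) : ℝ) := by positivity
      have hm : (1 : ℤ) - ((n : ℤ) + 2) ≠ 0 := by omega
      have habs : ((1 : ℤ) - ((n : ℤ) + 2)).natAbs = n + 1 := by omega
      have h1 := le_Ker_quarter hm
      rw [habs] at h1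
      have h2 := (mul_le_mul_of_nonneg_left h1 hc.le).trans (hle ((n : ℤ) + 2) (by omega))
      rw [← mul_assoc] at h2
      have h3 := Real.sqrt_le_sqrt h2
      rw [Real.sqrt_mul hC.le] at h3
      have h4 := Real.rpow_le_rpow (by positivity) h3 (by linarith [hq.1] : 0 ≤ q)
      rw [Real.mul_rpow (by positivity) (by positivity)] at h4
      refine le_trans (le_of_eq ?_) h4
      congr 1
      rw [Real.sqrt_eq_rpow, one_div, one_div, ← Real.rpow_neg hn.le, ← Real.rpow_neg hn.le,
        ← Real.rpow_mul hn.le, ← Real.rpow_mul hn.le]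
      congr 1
      ring
    have h5 := Summable.of_nonneg_of_le (fun n => by positivity) hlow hcomp
    rw [summable_mul_left_iff (by positivity),
      summable_nat_add_iff (f := fun n : ℕ => 1 / (n : ℝ) ^ (3 / 4 * q)) 1,
      Real.summable_one_div_nat_rpow] at h5
    linarith [hq.2]
  refine ⟨?_, hns⟩
  by_contra h
  refine hns ((ENNReal.summable_toReal h).congr fun x => ?_)
  rw [ENNReal.toReal_ofReal (hG0 x)]
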